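/- arXiv:1603.07162 — 3 statements merged into one kernel-verified Lean document; each statement's English description precedes it below -/
import Mathlib

section
/- Let c and c' be d-dimensional little cubes with parameters (a, b) and (a', b') respectively. Then interior (Im c) ∩ interior (Im c') = ∅ if and only if there exists an index i : Fin d such that the open intervals Ioo (a i) (a i + b i) and Ioo (a' i) (a' i + b' i) are disjoint. -/
/-- The closed unit cube `K_d ⊆ ℝ^d`. -/
def unitCube (d : ℕ) : Set (Fin d → ℝ) := {t | ∀ i, 0 ≤ t i ∧ t i ≤ 1}

/-- The interior of the image of the unit cube under a coordinatewise increasing affine map is an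
open box. -/
theorem interior_image_unitCube {d : ℕ} (c : (Fin d → ℝ) → (Fin d → ℝ)) (a b : Fin d → ℝ)
    (hb : ∀ i, 0 < b i) (hform : ∀ t i, c t i = a i + b i * t i) :
    interior (c '' unitCube d) = Set.univ.pi fun i => Set.Ioo (a i) (a i + b i) := by
  have himage : c '' unitCube d = Set.univ.pi fun i => Set.Icc (a i) (a i + b i) := by
    ext x
    simp only [Set.mem_image, Set.mem_univ_pi, Set.mem_Icc, unitCube, Set.mem_ofPred_eq]
    constructor
    · rintro ⟨t, ht, rfl⟩ i
      rw [hform]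
      have := hb i
      obtain ⟨h0, h1⟩ := ht i
      constructor <;> nlinarith
    · intro hx
      refine ⟨fun i => (x i - a i) / b i, fun i => ⟨?_, ?_⟩, ?_⟩
      · exact div_nonneg (by linarith [hx i]) (hb i).le
      · rw [div_le_one (hb i)]
        linarith [hx i]
      · ext i
        rw [hform, mul_div_cancel₀ _ (hb i).ne']
        ring
  rw [himage, interior_pi_set Set.finite_univ]
  simp only [interior_Icc]

/-- two little cubes have disjoint interiors of images iff in some
coordinate the corresponding open intervals are disjoint. -/
theorem disjoint_interiors_iff {d : ℕ}
    (c c' : (Fin d → ℝ) → (Fin d → ℝ)) (a b a' b' : Fin d → ℝ)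
    (hb : ∀ i, 0 < b i) (hb' : ∀ i, 0 < b' i)
    (hform : ∀ t i, c t i = a i + b i * t i)
    (hform' : ∀ t i, c' t i = a' i + b' i * t i)
    (hmap : ∀ t ∈ unitCube d, c t ∈ unitCube d)
    (hmap' : ∀ t ∈ unitCube d, c' t ∈ unitCube d) :
    interior (c '' unitCube d) ∩ interior (c' '' unitCube d) = ∅ ↔
      ∃ i : Fin d,
        Set.Ioo (a i) (a i + b i) ∩ Set.Ioo (a' i) (a' i + b' i) = ∅ := by
  rw [interior_image_unitCube c a b hb hform, interior_image_unitCube c' a' b' hb' hform',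
    ← Set.pi_inter_distrib, Set.univ_pi_eq_empty_iff]
end

section
/- Let c : Fin n → (d-dimensional little cubes) be a configuration with pairwise disjoint interiors, let c' : Fin m → (d-dimensional little cubes) be a configuration with pairwise disjoint interiors, and let i : Fin n. Then the operadic composite configuration c ∘_i c' of n + m - 1 little cubes (c 1, …, c (i-1), (c i) ∘ (c' 1), …, (c i) ∘ (c' m), c (i+1), …, c n) again has pairwise disjoint interiors. Concretely: (1) for all j ≠ k in Fin m, interior (Im ((c i) ∘ (c' j))) ∩ interior (Im ((c i) ∘ (c' k))) = ∅; and (2) for all j in Fin m and all k ≠ i in Fin n, interior (Im ((c i) ∘ (c' j))) ∩ interior (Im (c k)) = ∅. (This is the well-definedness of the operadic compositions ∘_i of the little cubes operad C_d.) -/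
/-- A `d`-dimensional little cube. -/
def IsLittleCube (d : ℕ) (c : (Fin d → ℝ) → (Fin d → ℝ)) : Prop :=
  ∃ a b : Fin d → ℝ, (∀ i, 0 < b i) ∧ (∀ t i, c t i = a i + b i * t i) ∧
    ∀ t ∈ unitCube d, c t ∈ unitCube d

/-- The image of a little cube. -/
def Im {d : ℕ} (c : (Fin d → ℝ) → (Fin d → ℝ)) : Set (Fin d → ℝ) :=
  c '' unitCube d

/-- A little cube is a homeomorphism of `ℝ^d`. -/
theorem IsLittleCube.isHomeomorph {d : ℕ} {c : (Fin d → ℝ) → (Fin d → ℝ)}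
    (hc : IsLittleCube d c) : IsHomeomorph c := by
  obtain ⟨a, b, hb, hab, -⟩ := hc
  obtain rfl : c = fun t i => a i + b i * t i := by
    funext t i
    exact hab t i
  refine isHomeomorph_iff_exists_inverse.2
    ⟨by fun_prop, fun t i => (t i - a i) / b i, fun t => ?_, fun t => ?_, by fun_prop⟩
  all_goals
    funext i
    have := (hb i).ne'
    field_simp
    ring

theorem IsLittleCube.interior_Im_comp {d : ℕ} {c c' : (Fin d → ℝ) → (Fin d → ℝ)}
    (hc : IsLittleCube d c) : interior (Im (c ∘ c')) = c '' interior (Im c') := by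
  rw [Im, Set.image_comp]
  exact (hc.isHomeomorph.homeomorph.image_interior _).symm

theorem IsLittleCube.Im_comp_subset {d : ℕ} {c c' : (Fin d → ℝ) → (Fin d → ℝ)}
    (hc' : IsLittleCube d c') : Im (c ∘ c') ⊆ Im c := by
  obtain ⟨_, _, -, -, hmaps⟩ := hc'
  rw [Im, Set.image_comp]
  exact Set.image_mono (Set.image_subset_iff.2 hmaps)

/-- the operadic composite of two configurations of little cubes
with pairwise disjoint interiors again has pairwise disjoint interiors. -/
theorem comp_disjoint_interiors {d n m : ℕ}
    (c : Fin n → (Fin d → ℝ) → (Fin d → ℝ))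
    (hc : ∀ j, IsLittleCube d (c j))
    (hdisj : ∀ j k : Fin n, j ≠ k → interior (Im (c j)) ∩ interior (Im (c k)) = ∅)
    (c' : Fin m → (Fin d → ℝ) → (Fin d → ℝ))
    (hc' : ∀ j, IsLittleCube d (c' j))
    (hdisj' : ∀ j k : Fin m, j ≠ k →
      interior (Im (c' j)) ∩ interior (Im (c' k)) = ∅)
    (i : Fin n) :
    (∀ j k : Fin m, j ≠ k →
      interior (Im (c i ∘ c' j)) ∩ interior (Im (c i ∘ c' k)) = ∅) ∧
    (∀ j : Fin m, ∀ k : Fin n, k ≠ i →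
      interior (Im (c i ∘ c' j)) ∩ interior (Im (c k)) = ∅) := by
  refine ⟨fun j k hjk => ?_, fun j k hki => ?_⟩
  · rw [(hc i).interior_Im_comp, (hc i).interior_Im_comp,
      ← Set.image_inter (hc i).isHomeomorph.injective, hdisj' j k hjk, Set.image_empty]
  · exact Set.subset_empty_iff.1 <|
      (Set.inter_subset_inter_left _ (interior_mono (hc' j).Im_comp_subset)).trans
        (hdisj i k hki.symm).subset
end

section
/- Let l ≥ 2. Let c : Fin n → (d-dimensional little cubes) be a non-(l)-overlapping configuration, let c' : Fin m → (d-dimensional little cubes) be a configuration with pairwise disjoint interiors, and let i : Fin n. Then the operadic composite configuration c ∘_i c' of n + m - 1 little cubes (obtained by replacing c i with the cubes (c i) ∘ (c' 1), …, (c i) ∘ (c' m)) is again non-(l)-overlapping. (This is the well-definedness of the right C_d-module structure ∘^i : C_d^{(l)}(n) × C_d(m) → C_d^{(l)}(n+m-1) of the non-(l)-overlapping little cubes bimodule.) -/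
/-- A configuration of little cubes indexed by `J` is non-`(l)`-overlapping if
any `l` distinct cube interiors have empty intersection. -/
def NonOverlapping (d l : ℕ) {J : Type*}
    (c : J → (Fin d → ℝ) → (Fin d → ℝ)) : Prop :=
  ∀ σ : Fin l → J, Function.Injective σ →
    (⋂ j : Fin l, interior (Im (c (σ j)))) = ∅

theorem IsLittleCube.continuous {d : ℕ} {c : (Fin d → ℝ) → (Fin d → ℝ)}
    (hc : IsLittleCube d c) : Continuous c := by
  obtain ⟨a, b, -, h, -⟩ := hc
  have h' : c = fun t i => a i + b i * t i := by
    funext t i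
    exact h t i
  rw [h']
  fun_prop

theorem IsLittleCube.injective {d : ℕ} {c : (Fin d → ℝ) → (Fin d → ℝ)}
    (hc : IsLittleCube d c) : Function.Injective c := by
  obtain ⟨a, b, hb, h, -⟩ := hc
  intro s t hst
  funext i
  have hi := congrFun hst i
  rw [h, h] at hi
  exact mul_left_cancel₀ (hb i).ne' (add_left_cancel hi)

/-- The interior of the image of a set under a continuous injection is contained in the image of
its interior. -/
theorem interior_image_subset_image_interior {X Y : Type*} [TopologicalSpace X]
    [TopologicalSpace Y] {f : X → Y} (hf : Continuous f) (hinj : Function.Injective f)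
    (s : Set X) : interior (f '' s) ⊆ f '' interior s := by
  intro y hy
  obtain ⟨x, -, rfl⟩ := interior_subset hy
  refine ⟨x, ?_, rfl⟩
  have hx := preimage_interior_subset_interior_preimage hf hy
  rwa [hinj.preimage_image] at hx

/-- Composing with a fixed little cube preserves disjointness of interiors. -/
theorem IsLittleCube.interior_Im_comp_inter {d : ℕ} {c c₁ c₂ : (Fin d → ℝ) → (Fin d → ℝ)}
    (hc : IsLittleCube d c) (h : interior (Im c₁) ∩ interior (Im c₂) = ∅) :
    interior (Im (c ∘ c₁)) ∩ interior (Im (c ∘ c₂)) = ∅ := by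
  have key (e : (Fin d → ℝ) → (Fin d → ℝ)) :
      interior (Im (c ∘ e)) ⊆ c '' interior (Im e) := by
    rw [Im, Set.image_comp]
    exact interior_image_subset_image_interior hc.continuous hc.injective _
  apply Set.subset_empty_iff.mp
  refine (Set.inter_subset_inter (key c₁) (key c₂)).trans ?_
  rw [← Set.image_inter hc.injective, h, Set.image_empty]

/-- the right `C_d`-module structure on the non-`(l)`-overlapping
little cubes bimodule is well defined: composing a non-`(l)`-overlapping
configuration with a configuration with pairwise disjoint interiors at slot `i`
yields a non-`(l)`-overlapping configuration. -/
theorem nonOverlapping_comp_right {d n m l : ℕ} (hl : 2 ≤ l)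
    (c : Fin n → (Fin d → ℝ) → (Fin d → ℝ))
    (hc : ∀ j, IsLittleCube d (c j))
    (hcl : NonOverlapping d l c)
    (c' : Fin m → (Fin d → ℝ) → (Fin d → ℝ))
    (hc' : ∀ j, IsLittleCube d (c' j))
    (hdisj' : ∀ j k : Fin m, j ≠ k →
      interior (Im (c' j)) ∩ interior (Im (c' k)) = ∅)
    (i : Fin n) :
    NonOverlapping d l
      (fun x : {k : Fin n // k ≠ i} ⊕ Fin m =>
        Sum.elim (fun k : {k : Fin n // k ≠ i} => c k.1)
          (fun j : Fin m => c i ∘ c' j) x) := by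
  intro σ hσ
  refine Set.eq_empty_iff_forall_notMem.mpr fun x hx => ?_
  rw [Set.mem_iInter] at hx
  let p : {k : Fin n // k ≠ i} ⊕ Fin m → Fin n := Sum.elim Subtype.val fun _ => i
  have hp : Function.Injective (p ∘ σ) := by
    intro a b hab
    apply hσ
    have ha := hx a
    have hb := hx b
    simp only [Function.comp_apply] at hab
    rcases hσa : σ a with k | j <;> rcases hσb : σ b with k' | j' <;>
      simp only [hσa, hσb, p, Sum.elim_inl, Sum.elim_inr] at hab ha hb
    · exact congrArg Sum.inl (Subtype.ext hab)
    · exact absurd hab k.2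
    · exact absurd hab.symm k'.2
    · by_contra hne
      have hjj : j ≠ j' := fun h => hne (congrArg Sum.inr h)
      have hempty := (hc i).interior_Im_comp_inter (hdisj' j j' hjj)
      exact Set.notMem_empty x (hempty ▸ ⟨ha, hb⟩)
  refine Set.notMem_empty x (hcl (p ∘ σ) hp ▸ Set.mem_iInter.mpr fun a => ?_)
  have ha := hx a
  rw [Function.comp_apply]
  rcases hσa : σ a with k | j <;> simp only [hσa, p, Sum.elim_inl, Sum.elim_inr] at ha ⊢
  · exact ha
  · exact interior_mono (hc' j).Im_comp_subset ha
end
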